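/- arXiv:1901.10801 — 2 statements merged into one kernel-verified Lean document; each statement's English description precedes it below -/
import Mathlib

section
/- Let T be even and let M, R ≥ 1. There exists a generalized RNN with rectifier nonlinearity, feature matrix F = I_M (the identity), and all hidden ranks at most R, such that every generalized shallow network with rectifier nonlinearity (with the same feature matrix F = I_M) whose grid tensor equals the grid tensor of this RNN has rank at least (2/(M·T))·min(M,R)^{T/2}. -/
/-- Standard inner product on `ℝ^M`. -/
noncomputable def ip {M : ℕ} (a b : Fin M → ℝ) : ℝ := ∑ m, a m * b m

/-- The rectifier nonlinearity `ξ(x, y) = max(x, y, 0)`. -/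
noncomputable def relu2 (x y : ℝ) : ℝ := max (max x y) 0

/-- Hidden states of a generalized RNN with `ξ`-nonlinearity `xi`, initial hidden state
`u`, input dimension `L`, hidden ranks `R`, input matrices `C` (`C t i` is the `i`-th row
of `C^{(t+1)}`), cores `G` (`G t i j k` is the entry `G^{(t+1)}_{ijk}`), feature matrix
`F` (whose `i`-th row is the feature vector of template `i`), on the input sequence of
templates `idx`.  `rnnHidden … t j` is the `j`-th entry of `h^{(t)}`; entries with
`j ≥ R t` are junk and are never read by the recursion. -/
noncomputable def rnnHidden (M : ℕ) (xi : ℝ → ℝ → ℝ) (u : ℝ)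
    (L : ℕ) (R : ℕ → ℕ)
    (C : ℕ → ℕ → Fin M → ℝ)
    (G : ℕ → ℕ → ℕ → ℕ → ℝ)
    (F : Matrix (Fin M) (Fin M) ℝ)
    (idx : ℕ → Fin M) : ℕ → ℕ → ℝ
  | 0, _ => u
  | t + 1, k => ∑ i ∈ Finset.range L, ∑ j ∈ Finset.range (R t),
      G t i j k * xi (ip (C t i) (F (idx t))) (rnnHidden M xi u L R C G F idx t j)

/-- A sum of `K` matrices, each of whose rows depend only on a label in `α`, has rank at most
`K * card α`. -/
theorem Matrix.rank_le_of_row_labels {m n α : Type*} [Fintype m] [Fintype n] [Fintype α] (K : ℕ)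
    (A : Matrix m n ℝ) (a : ℕ → m → α) (b : ℕ → α → n → ℝ)
    (hA : ∀ p q, A p q = ∑ r ∈ Finset.range K, b r (a r p) q) :
    A.rank ≤ K * Fintype.card α := by
  classical
  have hfac : A = (Matrix.of fun p (x : Fin K × α) => if a x.1 p = x.2 then (1 : ℝ) else 0) *
      (Matrix.of fun (x : Fin K × α) q => b x.1 x.2 q) := by
    ext p q
    rw [hA, Matrix.mul_apply, Fintype.sum_prod_type, ← Fin.sum_univ_eq_sum_range]
    simp
  rw [hfac]
  refine (Matrix.rank_mul_le_left _ _).trans ((Matrix.rank_le_card_width _).trans ?_)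
  simp

/-- A maximum over `2 * S` positions splits into the maxima over even and odd positions. -/
theorem fold_max_even_odd (S : ℕ) (f : ℕ → ℝ) :
    (Finset.univ : Finset (Fin (2 * S))).fold max 0 (fun t => f t.1) =
      max ((Finset.univ : Finset (Fin S)).fold max 0 fun s => f (2 * s.1))
        ((Finset.univ : Finset (Fin S)).fold max 0 fun s => f (2 * s.1 + 1)) := by
  refine eq_of_forall_ge_iff fun c => ?_
  simp only [max_le_iff, Finset.fold_max_le, Finset.mem_univ, true_imp_iff]
  constructor
  · rintro ⟨h0, h⟩
    exact ⟨⟨h0, fun s => h ⟨2 * s.1, by omega⟩⟩, h0, fun s => h ⟨2 * s.1 + 1, by omega⟩⟩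
  · rintro ⟨⟨h0, h1⟩, -, h2⟩
    refine ⟨h0, fun t => ?_⟩
    have h (u : ℕ) : u < 2 * S → f u ≤ c := by
      obtain ⟨k, rfl | rfl⟩ := Nat.even_or_odd' u
      · exact fun hu => h1 ⟨k, by omega⟩
      · exact fun hu => h2 ⟨k, by omega⟩
    exact h t.1 t.2

/-- A maximum of values with `0`, over a nonempty index set, is one of the rectified values. -/
theorem exists_fold_max_eq {ι : Type*} [Fintype ι] [Nonempty ι] (f : ι → ℝ) :
    ∃ i, (Finset.univ : Finset ι).fold max 0 f = max 0 (f i) := by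
  obtain ⟨i, hi⟩ := Finite.exists_max f
  refine ⟨i, eq_of_forall_ge_iff fun c => ?_⟩
  simp only [max_le_iff, Finset.fold_max_le, Finset.mem_univ, true_imp_iff]
  exact and_congr_right fun _ => ⟨fun h => h i, fun h j => (hi j).trans h⟩

/-- Ranks of the matching RNN: `1` after a completed pair, `N` inside a pair. -/
def matchRank (N t : ℕ) : ℕ := if t % 2 = 0 then 1 else N

/-- Input features of the matching RNN: feature `i < N` vanishes exactly on template `i`, and
feature `N` is constant. -/
noncomputable def matchInput {M : ℕ} (N i : ℕ) (m : Fin M) : ℝ :=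
  if i < N ∧ m.1 = i then 0 else 1

/-- Cores of the matching RNN on `2 * S` inputs.  The hidden state after a pair is `0` if all
pairs so far consist of equal templates below `N` and `1` otherwise; the last core swaps these
two values. -/
noncomputable def matchCore (S N t i j k : ℕ) : ℝ :=
  if t % 2 = 0 then (if i = k then 1 else 0)
  else (if t + 1 = 2 * S then -1 else 1) * (if i = j then 1 else 0) +
    (if t + 1 = 2 * S then (N : ℝ) else 1 - N) * (if i = N ∧ j = 0 then 1 else 0)

/-- Hidden states of the matching RNN. -/
noncomputable def matchHidden (S M N : ℕ) (idx : ℕ → Fin M) : ℕ → ℕ → ℝ :=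
  rnnHidden M relu2 0 (N + 1) (matchRank N) (fun _ i => matchInput N i) (matchCore S N)
    (1 : Matrix (Fin M) (Fin M) ℝ) idx

theorem ip_one_right {M : ℕ} (a : Fin M → ℝ) (m : Fin M) :
    ip a ((1 : Matrix (Fin M) (Fin M) ℝ) m) = a m := by
  simp [ip, Matrix.one_apply]

theorem ip_one_left {M : ℕ} (a : Fin M → ℝ) (m : Fin M) :
    ip ((1 : Matrix (Fin M) (Fin M) ℝ) m) a = a m := by
  simp [ip, Matrix.one_apply]

theorem matchHidden_succ (S M N : ℕ) (idx : ℕ → Fin M) (t k : ℕ) :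
    matchHidden S M N idx (t + 1) k =
      ∑ i ∈ Finset.range (N + 1), ∑ j ∈ Finset.range (matchRank N t),
        matchCore S N t i j k * relu2 (matchInput N i (idx t)) (matchHidden S M N idx t j) := by
  simp only [matchHidden, rnnHidden, ip_one_right]

theorem relu2_matchInput {M N : ℕ} (i : ℕ) (m : Fin M) (P : Prop) [Decidable P] :
    relu2 (matchInput N i m) (if P then 0 else 1) =
      if (i < N ∧ m.1 = i) ∧ P then 0 else 1 := by
  unfold relu2 matchInput
  by_cases h : i < N ∧ m.1 = i <;> by_cases hP : P <;> simp [h, hP]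

theorem matchHidden_inside_pair {S M N : ℕ} (idx : ℕ → Fin M) (s : ℕ) (P : Prop) [Decidable P]
    (h : matchHidden S M N idx (2 * s) 0 = if P then 0 else 1) {k : ℕ} (hk : k < N) :
    matchHidden S M N idx (2 * s + 1) k = if (idx (2 * s)).1 = k ∧ P then 0 else 1 := by
  rw [matchHidden_succ]
  simp only [matchRank, matchCore, Nat.mul_mod_right, if_true, Finset.sum_range_one, h,
    relu2_matchInput, ite_mul, one_mul, zero_mul]
  rw [Finset.sum_ite_eq' (Finset.range (N + 1)) k, if_pos (Finset.mem_range.2 (by omega))]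
  simp [hk]

theorem matchHidden_pair {S M N : ℕ} (hN : 0 < N) (idx : ℕ → Fin M) (s : ℕ) (P : Prop) [Decidable P]
    (h : matchHidden S M N idx (2 * s) 0 = if P then 0 else 1) :
    matchHidden S M N idx (2 * s + 2) 0 =
      if P ∧ idx (2 * s) = idx (2 * s + 1) ∧ (idx (2 * s)).1 < N then
        (if s + 1 = S then 1 else 0) else (if s + 1 = S then 0 else 1) := by
  have hin := fun k (hk : k < N) => matchHidden_inside_pair idx s P h hk
  have hmod : (2 * s + 1) % 2 = 1 := by omega
  have hlast : (2 * s + 1 + 1 = 2 * S) = (s + 1 = S) := propext (by omega)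
  have hinner : ∀ i ∈ Finset.range (N + 1), ∑ j ∈ Finset.range N, matchCore S N (2 * s + 1) i j 0 *
        relu2 (matchInput N i (idx (2 * s + 1))) (matchHidden S M N idx (2 * s + 1) j) =
      ∑ j ∈ Finset.range N, matchCore S N (2 * s + 1) i j 0 *
        if (i < N ∧ (idx (2 * s + 1)).1 = i) ∧ (idx (2 * s)).1 = j ∧ P then 0 else 1 :=
    fun i _ => Finset.sum_congr rfl fun j hj => by
      rw [hin j (Finset.mem_range.1 hj), relu2_matchInput]
  rw [matchHidden_succ, matchRank, hmod, if_neg one_ne_zero, Finset.sum_congr rfl hinner,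
    Finset.sum_range_succ]
  have hlow : ∀ i ∈ Finset.range N, ∑ j ∈ Finset.range N, matchCore S N (2 * s + 1) i j 0 *
        (if (i < N ∧ (idx (2 * s + 1)).1 = i) ∧ (idx (2 * s)).1 = j ∧ P then (0 : ℝ) else 1) =
      (if s + 1 = S then -1 else 1) * (1 - if (idx (2 * s)).1 = i then
        (if P ∧ idx (2 * s) = idx (2 * s + 1) then 1 else 0) else 0) := by
    intro i hi
    have hi' := Finset.mem_range.1 hi
    rw [Finset.sum_eq_single i]
    · simp only [matchCore, hmod, hlast, one_ne_zero, if_false, if_true, hi', hi'.ne, false_and,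
        true_and, mul_one, mul_zero, add_zero, Fin.ext_iff]
      congr 1
      by_cases h1 : (idx (2 * s)).1 = i <;> by_cases h2 : P <;>
        by_cases h3 : (idx (2 * s + 1)).1 = i <;> grind
    · intro j _ hj
      simp [matchCore, hmod, hi'.ne, hj.symm]
    · exact fun h => absurd hi h
  have htop : ∑ j ∈ Finset.range N, matchCore S N (2 * s + 1) N j 0 *
        (if (N < N ∧ (idx (2 * s + 1)).1 = N) ∧ (idx (2 * s)).1 = j ∧ P then (0 : ℝ) else 1) =
      if s + 1 = S then (N : ℝ) else 1 - N := by
    rw [Finset.sum_eq_single 0]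
    · simp [matchCore, hmod, hlast, hN.ne']
    · intro j hj hj0
      have := (Finset.mem_range.1 hj).ne'
      simp [matchCore, hmod, hj0, this]
    · exact fun h => absurd (Finset.mem_range.2 hN) h
  rw [Finset.sum_congr rfl hlow, htop, ← Finset.mul_sum, Finset.sum_sub_distrib,
    Finset.sum_ite_eq (Finset.range N)]
  by_cases h1 : (idx (2 * s)).1 < N <;> by_cases h2 : P <;>
    by_cases h3 : idx (2 * s) = idx (2 * s + 1) <;> by_cases h4 : s + 1 = S <;>
    simp [h1, h2, h3, h4] <;> grind

theorem matchHidden_two_mul {S M N : ℕ} (hN : 0 < N) (idx : ℕ → Fin M) (s : ℕ) (hs : s < S) :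
    matchHidden S M N idx (2 * s) 0 =
      if ∀ r < s, idx (2 * r) = idx (2 * r + 1) ∧ (idx (2 * r)).1 < N then 0 else 1 := by
  induction s with
  | zero => simp [matchHidden, rnnHidden]
  | succ s ih =>
    rw [Nat.mul_succ, matchHidden_pair hN idx s _ (ih (by omega))]
    simp only [hs.ne, if_false]
    exact if_congr Nat.forall_lt_succ_right.symm rfl rfl

/-- The grid tensor of the matching RNN is the indicator of all pairs being equal templates
below `N`. -/
theorem matchHidden_final {S M N : ℕ} (hS : 0 < S) (hN : 0 < N) (idx : ℕ → Fin M) :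
    matchHidden S M N idx (2 * S) 0 =
      if ∀ r < S, idx (2 * r) = idx (2 * r + 1) ∧ (idx (2 * r)).1 < N then 1 else 0 := by
  obtain ⟨s, rfl⟩ := Nat.exists_eq_add_one_of_ne_zero hS.ne'
  rw [Nat.mul_succ, matchHidden_pair hN idx s _ (matchHidden_two_mul hN idx s s.lt_succ_self)]
  simp only [if_true]
  exact if_congr Nat.forall_lt_succ_right.symm rfl rfl

/-- The sequence of `2 * S` templates with `p` on the even and `q` on the odd positions. -/
def interleave {S M N : ℕ} (hM : 0 < M) (hNM : N ≤ M) (p q : Fin S → Fin N) (t : ℕ) : Fin M :=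
  if h : t / 2 < S then
    (if t % 2 = 0 then p ⟨t / 2, h⟩ else q ⟨t / 2, h⟩).castLE hNM
  else ⟨0, hM⟩

theorem interleave_even {S M N : ℕ} (hM : 0 < M) (hNM : N ≤ M) (p q : Fin S → Fin N)
    (s : Fin S) : interleave hM hNM p q (2 * s.1) = (p s).castLE hNM := by
  simp [interleave]

theorem interleave_odd {S M N : ℕ} (hM : 0 < M) (hNM : N ≤ M) (p q : Fin S → Fin N)
    (s : Fin S) : interleave hM hNM p q (2 * s.1 + 1) = (q s).castLE hNM := by
  have h1 : (2 * s.1 + 1) / 2 = s.1 := by omega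
  have h2 : (2 * s.1 + 1) % 2 = 1 := by omega
  simp [interleave, h1, h2]

theorem matchHidden_interleave {S M N : ℕ} (hS : 0 < S) (hM : 0 < M) (hN : 0 < N) (hNM : N ≤ M)
    (p q : Fin S → Fin N) :
    matchHidden S M N (interleave hM hNM p q) (2 * S) 0 =
      (1 : Matrix (Fin S → Fin N) (Fin S → Fin N) ℝ) p q := by
  classical
  rw [matchHidden_final hS hN, Matrix.one_apply]
  refine if_congr ?_ rfl rfl
  rw [funext_iff]
  constructor
  · intro h s
    have := (h s.1 s.2).1
    rw [interleave_even, interleave_odd] at this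
    exact Fin.castLE_injective hNM this
  · intro h r hr
    have he := interleave_even hM hNM p q ⟨r, hr⟩
    have ho := interleave_odd hM hNM p q ⟨r, hr⟩
    dsimp only at he ho
    rw [he, ho, h]
    exact ⟨rfl, (q ⟨r, hr⟩).2⟩

/-- A shallow network realizing the grid tensor of the matching RNN has exponential rank. -/
theorem pow_le_of_shallow_eq_matchHidden {S M N : ℕ} (hS : 0 < S) (hM : 0 < M) (hN : 0 < N)
    (hNM : N ≤ M) (K : ℕ) (lam : ℕ → ℝ) (v : ℕ → ℕ → Fin M → ℝ)
    (h : ∀ idx : ℕ → Fin M, ∑ r ∈ Finset.range K,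
      lam r * (Finset.univ : Finset (Fin (2 * S))).fold max 0 (fun t => v r t.1 (idx t.1)) =
        matchHidden S M N idx (2 * S) 0) :
    N ^ S ≤ K * (N * S) := by
  have : Nonempty (Fin S) := ⟨⟨0, hS⟩⟩
  choose σ hσ using fun (r : ℕ) (p : Fin S → Fin N) =>
    exists_fold_max_eq fun s : Fin S => v r (2 * s.1) ((p s).castLE hNM)
  have hrank := Matrix.rank_le_of_row_labels K (1 : Matrix (Fin S → Fin N) (Fin S → Fin N) ℝ)
    (fun r p => (p (σ r p), σ r p))
    (fun r x q => lam r * max (max 0 (v r (2 * x.2.1) (x.1.castLE hNM)))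
      ((Finset.univ : Finset (Fin S)).fold max 0
        fun s => v r (2 * s.1 + 1) ((q s).castLE hNM))) fun p q => by
    rw [← matchHidden_interleave hS hM hN hNM, ← h]
    refine Finset.sum_congr rfl fun r _ => ?_
    rw [fold_max_even_odd S fun t => v r t (interleave hM hNM p q t)]
    simp only [interleave_even, interleave_odd, hσ]
  simpa [Matrix.rank_one] using hrank

/-- Expressivity I: let `T = 2*S` be even and `M, R ≥ 1`.  There exists a
generalized RNN with rectifier nonlinearity, feature matrix `F = I_M`, and all hidden
ranks at most `R` (ranks positive, `R 0 = R T = 1`), such that every generalized shallow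
network with rectifier nonlinearity (same feature matrix `I_M`) whose grid tensor equals
the grid tensor of this RNN has rank `Rk` at least `(2/(M·T))·min(M,R)^{T/2}`. -/
theorem rnn_relu_expressivity_I (S M R : ℕ) (hM : 1 ≤ M) (hR : 1 ≤ R) :
    ∃ (L : ℕ) (Rr : ℕ → ℕ) (C : ℕ → ℕ → Fin M → ℝ) (G : ℕ → ℕ → ℕ → ℕ → ℝ),
      Rr 0 = 1 ∧ Rr (2 * S) = 1 ∧ (∀ t, 1 ≤ t → t < 2 * S → Rr t ≤ R) ∧
      (∀ t, 1 ≤ Rr t) ∧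
      ∀ (Rk : ℕ) (lam : ℕ → ℝ) (v : ℕ → ℕ → Fin M → ℝ),
        (∀ idx : ℕ → Fin M,
          ∑ r ∈ Finset.range Rk,
              lam r * (Finset.univ : Finset (Fin (2 * S))).fold max 0
                (fun t => ip ((1 : Matrix (Fin M) (Fin M) ℝ) (idx t.1)) (v r t.1))
            = rnnHidden M relu2 0 L Rr C G (1 : Matrix (Fin M) (Fin M) ℝ) idx (2 * S) 0) →
        (2 : ℝ) / ((M : ℝ) * (2 * (S : ℝ))) * ((min M R : ℕ) : ℝ) ^ S ≤ (Rk : ℝ) := by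
  have hNM : min M R ≤ M := min_le_left _ _
  have hN : 0 < min M R := by omega
  refine ⟨min M R + 1, matchRank (min M R), fun _ i => matchInput (min M R) i,
    matchCore S (min M R), by simp [matchRank], by simp [matchRank], ?_, ?_, ?_⟩
  · intro t _ _
    unfold matchRank
    split_ifs <;> omega
  · intro t
    unfold matchRank
    split_ifs <;> omega
  intro K lam v h
  obtain rfl | hS := Nat.eq_zero_or_pos S
  · simp
  have hbound := pow_le_of_shallow_eq_matchHidden hS hM hN hNM K lam v fun idx => by
    simpa only [ip_one_left, matchHidden] using h idx
  have hbound' : ((min M R : ℕ) : ℝ) ^ S ≤ K * (M * S) := by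
    exact_mod_cast hbound.trans (by gcongr)
  have hM' : (0 : ℝ) < M := by exact_mod_cast hM
  have hS' : (0 : ℝ) < S := by exact_mod_cast hS
  rw [div_mul_eq_mul_div, div_le_iff₀ (by positivity)]
  linarith
end

section
/- Let T be even and let M, R ≥ 1. There exists a generalized RNN with rectifier nonlinearity, feature matrix F = I_M, and all hidden ranks at most R, whose grid tensor Γ satisfies: Γ_{i_1…i_T} = 0 whenever i_{2s-1} = i_{2s} and i_{2s} ≤ min(M,R) for every s ∈ {1,…,T/2}, and Γ_{i_1…i_T} = 1 for every other multi-index (i_1,…,i_T) ∈ {1,…,M}^T. (The RNN measures pairwise similarity of consecutive inputs.) -/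
/-- Row `i` of the input matrix detects the mismatch with template `i`; the row `i = M` is
constantly one. -/
noncomputable def mismatchRow (M : ℕ) (_t i : ℕ) (x : Fin M) : ℝ :=
  if x.1 = i then 0 else 1

/-- At even times the core spreads the single hidden unit over all mismatch rows; at odd times it
sums the diagonal and subtracts the constant that normalizes the result to `{0, 1}`. -/
noncomputable def similarityCore (M m t i j k : ℕ) : ℝ :=
  if Even t then (if i = k then 1 else 0)
  else (if i = j then 1 else 0) + (if i = M then (if j = 0 then 1 - (m : ℝ) else 0) else 0)

/-- Hidden ranks alternating between `1` and `m`. -/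
def alternatingRank (m t : ℕ) : ℕ := if Even t then 1 else m

lemma ip_one_row {M : ℕ} (a : Fin M → ℝ) (x : Fin M) :
    ip a ((1 : Matrix (Fin M) (Fin M) ℝ) x) = a x := by
  simp [ip, Matrix.one_apply]

/-- The hidden states of the pairwise-similarity network. -/
noncomputable def similarityHidden (M m : ℕ) (idx : ℕ → Fin M) : ℕ → ℕ → ℝ :=
  rnnHidden M relu2 0 (M + 1) (alternatingRank m) (mismatchRow M) (similarityCore M m)
    (1 : Matrix (Fin M) (Fin M) ℝ) idx

section Hidden

variable {M m : ℕ} (idx : ℕ → Fin M)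

lemma similarityHidden_odd (n : ℕ) {k : ℕ} (hk : k < M) :
    similarityHidden M m idx (2 * n + 1) k
      = relu2 (if (idx (2 * n)).1 = k then 0 else 1) (similarityHidden M m idx (2 * n) 0) := by
  have hkM : k < M + 1 := by omega
  simp [similarityHidden, rnnHidden, ip_one_row, alternatingRank, similarityCore, mismatchRow,
    hkM]

lemma similarityHidden_even_succ (hm : 1 ≤ m) (hmM : m ≤ M) (n : ℕ) :
    similarityHidden M m idx (2 * (n + 1)) 0
      = ∑ j ∈ Finset.range m, relu2 (if (idx (2 * n + 1)).1 = j then 0 else 1)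
          (similarityHidden M m idx (2 * n + 1) j)
        + (1 - m) * relu2 1 (similarityHidden M m idx (2 * n + 1) 0) := by
  have hodd : ¬ Even (2 * n + 1) := by simp
  have hidx : (idx (2 * n + 1)).1 ≠ M := (idx (2 * n + 1)).2.ne
  change rnnHidden _ _ _ _ _ _ _ _ _ (2 * n + 1 + 1) _ = _
  rw [rnnHidden]
  simp only [ip_one_row, alternatingRank, similarityCore, mismatchRow, if_neg hodd, add_mul,
    Finset.sum_add_distrib]
  congr 1
  · rw [Finset.sum_comm]
    refine Finset.sum_congr rfl fun j hj => ?_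
    have hjM : j < M + 1 := by have := Finset.mem_range.1 hj; omega
    simp [hjM, similarityHidden]
  · rw [Finset.sum_comm, Finset.sum_eq_single_of_mem 0 (Finset.mem_range.2 hm)]
    · simp [hidx, similarityHidden]
    · intro j _ hj
      simp [hj]

lemma similarityHidden_even (hm : 1 ≤ m) (hmM : m ≤ M) (n : ℕ) :
    similarityHidden M m idx (2 * n) 0
      = if ∀ s < n, idx (2 * s) = idx (2 * s + 1) ∧ (idx (2 * s)).1 < m then 0 else 1 := by
  induction n with
  | zero => simp [similarityHidden, rnnHidden]
  | succ n ih =>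
    have hterm : ∀ j ∈ Finset.range m,
        relu2 (if (idx (2 * n + 1)).1 = j then 0 else 1)
          (similarityHidden M m idx (2 * n + 1) j)
        = 1 - if (idx (2 * n)).1 = j then
            (if ∀ s < n + 1, idx (2 * s) = idx (2 * s + 1) ∧ (idx (2 * s)).1 < m then 1 else 0)
            else 0 := by
      intro j hj
      have hjm := Finset.mem_range.1 hj
      rw [similarityHidden_odd idx n (hjm.trans_le hmM), ih]
      simp only [Nat.forall_lt_succ_right, Fin.ext_iff]
      by_cases hall : ∀ s < n, (idx (2 * s)).1 = (idx (2 * s + 1)).1 ∧ (idx (2 * s)).1 < m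
      · simp only [if_pos hall, and_iff_right hall]
        clear hall ih
        split_ifs <;> simp [relu2] <;> omega
      · simp only [hall, false_and, if_false]
        split_ifs <;> simp [relu2]
    have hconst : relu2 1 (similarityHidden M m idx (2 * n + 1) 0) = 1 := by
      rw [similarityHidden_odd idx n (hm.trans hmM), ih]
      split_ifs <;> simp [relu2]
    rw [similarityHidden_even_succ idx hm hmM, Finset.sum_congr rfl hterm, hconst,
      Finset.sum_sub_distrib, Finset.sum_ite_eq]
    split_ifs with hlt hall hall
    · simp
    · simp
    · exact absurd (hall n n.lt_succ_self).2 (by simpa using hlt)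
    · simp

end Hidden

/-- pairwise-similarity RNN: let `T = 2*S` be even and `M, R ≥ 1`.  There
exists a generalized RNN with rectifier nonlinearity, feature matrix `F = I_M`, and all
hidden ranks at most `R` (ranks positive, `R 0 = R T = 1`), whose grid tensor `Γ`
satisfies: `Γ_{i_1…i_T} = 0` whenever each consecutive pair satisfies
`i_{2s-1} = i_{2s}` with `i_{2s} ≤ min(M,R)` (0-based: `idx(2s) = idx(2s+1)` with value
`< min M R`), and `Γ_{i_1…i_T} = 1` otherwise. -/
theorem rnn_relu_pairwise_similarity (S M R : ℕ) (hM : 1 ≤ M) (hR : 1 ≤ R) :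
    ∃ (L : ℕ) (Rr : ℕ → ℕ) (C : ℕ → ℕ → Fin M → ℝ) (G : ℕ → ℕ → ℕ → ℕ → ℝ),
      Rr 0 = 1 ∧ Rr (2 * S) = 1 ∧ (∀ t, 1 ≤ t → t < 2 * S → Rr t ≤ R) ∧
      (∀ t, 1 ≤ Rr t) ∧
      ∀ idx : ℕ → Fin M,
        rnnHidden M relu2 0 L Rr C G (1 : Matrix (Fin M) (Fin M) ℝ) idx (2 * S) 0
          = if ∀ s : Fin S, idx (2 * s.1) = idx (2 * s.1 + 1)
                ∧ (idx (2 * s.1)).1 < min M R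
            then 0 else 1 := by
  have hm : 1 ≤ min M R := le_min hM hR
  refine ⟨M + 1, alternatingRank (min M R), mismatchRow M, similarityCore M (min M R),
    by simp [alternatingRank], by simp [alternatingRank], fun t _ _ => ?_, fun t => ?_,
    fun idx => ?_⟩
  · unfold alternatingRank
    split_ifs
    exacts [hR, min_le_right M R]
  · unfold alternatingRank
    split_ifs
    exacts [le_rfl, hm]
  · rw [← similarityHidden, similarityHidden_even idx hm (min_le_left M R)]
    simp only [Fin.forall_iff]
end
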